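/- arXiv:2603.27795 — 2 statements merged into one kernel-verified Lean document; each statement's English description precedes it below -/
import Mathlib

section
/- Let ε ∈ (0, 1/4), δ = ε², and γ = ε⁵/10³. Let Q be a finite sequence of vertices of M such that (1) |Q| ≤ (ε²/100)·opt, and (2) for every vertex v ∈ M \ Q, Pr_{G*~G_p}[v ∈ PROBLEMATIC(Q, G*)] < δ. For each realization G*, define A(G*) = {v ∈ M \ Q : v has at least 1/(p·γ) neighbors in G[M] belonging to UNDECIDED(Q, G*)} and SEED(G*) = L ∪ Q ∪ DECIDED(Q, G*) ∪ A(G*). Then E[|SEED(G*) \ MVC(G*)|] ≤ 6ε·opt. -/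
open Finset

noncomputable section
open scoped Classical

variable {V : Type*} [Fintype V] [DecidableEq V]

/-- The probability that the realized graph `G* ~ G_p` (each edge of the base edge set `E`
kept independently with probability `p`) has edge set exactly `F`. -/
def edgeWeight (p : ℝ) (E F : Finset (Sym2 V)) : ℝ :=
  p ^ F.card * (1 - p) ^ (E \ F).card

/-- The probability of an event `A` of the realized graph `G* ~ G_p`, where `E` is the
edge set of the base graph. -/
def probEvent (p : ℝ) (E : Finset (Sym2 V)) (A : Finset (Sym2 V) → Prop) : ℝ :=
  ∑ F ∈ E.powerset, if A F then edgeWeight p E F else 0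

/-- The expectation of a real-valued function of the realized graph `G* ~ G_p`. -/
def expVal (p : ℝ) (E : Finset (Sym2 V)) (X : Finset (Sym2 V) → ℝ) : ℝ :=
  ∑ F ∈ E.powerset, edgeWeight p E F * X F

/-- `C` is a vertex cover of the graph with edge set `F`. -/
def IsCoverOf (C : Finset V) (F : Finset (Sym2 V)) : Prop :=
  ∀ e ∈ F, ∃ v ∈ C, v ∈ e

/-- `MVC` assigns to every spanning subgraph of the base graph (given by its edge set
`F ⊆ E`) a vertex cover of minimum size. -/
def IsMinCoverFn (E : Finset (Sym2 V)) (MVC : Finset (Sym2 V) → Finset V) : Prop :=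
  ∀ F ⊆ E, IsCoverOf (MVC F) F ∧ ∀ C : Finset V, IsCoverOf C F → (MVC F).card ≤ C.card

/-- `opt = E[|MVC(G*)|]`. -/
def optVal (p : ℝ) (E : Finset (Sym2 V)) (MVC : Finset (Sym2 V) → Finset V) : ℝ :=
  expVal p E fun F => ((MVC F).card : ℝ)

/-- The number of edges of the induced subgraph `G[V \ S]` of the base graph. -/
def inducedEdgeCount (G : SimpleGraph V) [DecidableRel G.Adj] (S : Finset V) : ℕ :=
  (G.edgeFinset.filter fun e => ∀ v ∈ e, v ∉ S).card

/-- `DECIDED(Q, G*)` relative to the induced graphs on `M`: vertices of `M \ Q` having a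
neighbor in `G*[M]` (realized edge set `F`) belonging to `Q \ VC(G*)`. -/
def decidedM (VC : Finset (Sym2 V) → Finset V) (M Q : Finset V)
    (F : Finset (Sym2 V)) : Finset V :=
  (M \ Q).filter fun v => ∃ u ∈ Q \ VC F, s(u, v) ∈ F

/-- `UNDECIDED(Q, G*) = (M \ Q) \ DECIDED(Q, G*)`. -/
def undecidedM (VC : Finset (Sym2 V) → Finset V) (M Q : Finset V)
    (F : Finset (Sym2 V)) : Finset V :=
  (M \ Q) \ decidedM VC M Q F

/-- The set `A(G*)`: vertices of `M \ Q` with at least `1/(p·γ)` neighbors in `G[M]`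
belonging to `UNDECIDED(Q, G*)`. -/
def heavySetM (G : SimpleGraph V) [DecidableRel G.Adj] (p γ : ℝ)
    (VC : Finset (Sym2 V) → Finset V) (M Q : Finset V) (F : Finset (Sym2 V)) : Finset V :=
  (M \ Q).filter fun v =>
    1 / (p * γ) ≤ (((G.neighborFinset v ∩ M) ∩ undecidedM VC M Q F).card : ℝ)

/-- `PROBLEMATIC(Q, G*)` relative to the induced graphs on `M`: vertices `v ∈ M \ Q` with
`v ∉ VC(G*)` having at least `1/(p·γ)` neighbors in `G[M]` in `UNDECIDED(Q, G*)`. -/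
def problematicM (G : SimpleGraph V) [DecidableRel G.Adj] (p γ : ℝ)
    (VC : Finset (Sym2 V) → Finset V) (M Q : Finset V) (F : Finset (Sym2 V)) : Finset V :=
  (M \ Q).filter fun v => v ∉ VC F ∧
    1 / (p * γ) ≤ (((G.neighborFinset v ∩ M) ∩ undecidedM VC M Q F).card : ℝ)

lemma aux_weight_nonneg (p : ℝ) (hp0 : 0 < p) (hp1 : p ≤ 1) (E F : Finset (Sym2 V)) :
    0 ≤ edgeWeight p E F :=
  mul_nonneg (pow_nonneg hp0.le _) (pow_nonneg (by linarith) _)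

lemma aux_weight_sum (p : ℝ) (E : Finset (Sym2 V)) :
    ∑ F ∈ E.powerset, edgeWeight p E F = 1 := by
  have h := Finset.prod_add (fun _ : Sym2 V => p) (fun _ => 1 - p) E
  simp only [Finset.prod_const] at h
  unfold edgeWeight
  rw [← h]
  simp

lemma aux_mono (p : ℝ) (hp0 : 0 < p) (hp1 : p ≤ 1) (E : Finset (Sym2 V))
    (A B : Finset (Sym2 V) → Prop) (h : ∀ F ⊆ E, A F → B F) :
    probEvent p E A ≤ probEvent p E B := by
  unfold probEvent
  refine Finset.sum_le_sum fun F hF => ?_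
  have := aux_weight_nonneg p hp0 hp1 E F
  have := h F (Finset.mem_powerset.1 hF)
  split_ifs <;> first | tauto | linarith

lemma aux_nonneg (p : ℝ) (hp0 : 0 < p) (hp1 : p ≤ 1) (E : Finset (Sym2 V))
    (A : Finset (Sym2 V) → Prop) : 0 ≤ probEvent p E A := by
  unfold probEvent
  refine Finset.sum_nonneg fun F hF => ?_
  have := aux_weight_nonneg p hp0 hp1 E F
  split_ifs <;> linarith

lemma aux_compl (p : ℝ) (E : Finset (Sym2 V)) (A : Finset (Sym2 V) → Prop) :
    probEvent p E (fun F => ¬ A F) = 1 - probEvent p E A := by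
  rw [← aux_weight_sum p E, eq_sub_iff_add_eq]
  unfold probEvent
  rw [← Finset.sum_add_distrib]
  refine Finset.sum_congr rfl fun F _ => ?_
  by_cases h : A F <;> simp [h]

lemma aux_card (p : ℝ) (E : Finset (Sym2 V)) (S : Finset (Sym2 V) → Finset V) :
    expVal p E (fun F => ((S F).card : ℝ)) = ∑ v, probEvent p E (fun F => v ∈ S F) := by
  unfold expVal probEvent
  rw [Finset.sum_comm]
  refine Finset.sum_congr rfl fun F _ => ?_
  have h : edgeWeight p E F * ((S F).card : ℝ) = ∑ x ∈ S F, edgeWeight p E F := by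
    rw [Finset.sum_const, nsmul_eq_mul, mul_comm]
  refine h.trans ?_
  refine Eq.trans (Finset.sum_congr rfl fun x hx => ?_)
    (Finset.sum_subset (Finset.subset_univ (S F)) fun x _ hx => ?_)
  · exact (if_pos hx).symm
  · exact if_neg hx

/-- Lemma 4.5 with explicit constants. Let `ε ∈ (0, 1/4)`, `δ = ε²`,
`γ = ε⁵/10³`. Let `Q` be a set of vertices of `M` with (1) `|Q| ≤ (ε²/100)·opt` and
(2) for every `v ∈ M \ Q`, `Pr_{G*~G_p}[v ∈ PROBLEMATIC(Q, G*)] < δ`. With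
`A(G*) = {v ∈ M \ Q : v has ≥ 1/(p·γ) neighbors in G[M] in UNDECIDED(Q, G*)}` and
`SEED(G*) = L ∪ Q ∪ DECIDED(Q, G*) ∪ A(G*)`, we have
`E[|SEED(G*) \ MVC(G*)|] ≤ 6ε·opt`. -/
theorem seed_excess_bound
    (G : SimpleGraph V) [DecidableRel G.Adj]
    (p : ℝ) (hp0 : 0 < p) (hp1 : p ≤ 1)
    (MVC : Finset (Sym2 V) → Finset V)
    (hMVC : IsMinCoverFn G.edgeFinset MVC)
    (opt : ℝ) (hopt : opt = optVal p G.edgeFinset MVC)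
    (ε : ℝ) (hε0 : 0 < ε) (hε1 : ε < 1 / 4)
    (δ γ : ℝ) (hδ : δ = ε ^ 2) (hγ : γ = ε ^ 5 / 10 ^ 3)
    (L M : Finset V)
    (hL : L = Finset.univ.filter fun v =>
      1 - 2 * ε ≤ probEvent p G.edgeFinset fun F => v ∈ MVC F)
    (hM : M = Finset.univ.filter fun v =>
      ε < probEvent p G.edgeFinset (fun F => v ∈ MVC F) ∧
      probEvent p G.edgeFinset (fun F => v ∈ MVC F) < 1 - 2 * ε)
    (Q : Finset V) (hQ : Q ⊆ M)
    (hQcard : (Q.card : ℝ) ≤ ε ^ 2 / 100 * opt)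
    (hprob : ∀ v ∈ M \ Q,
      probEvent p G.edgeFinset (fun F => v ∈ problematicM G p γ MVC M Q F) < δ) :
    expVal p G.edgeFinset
        (fun F =>
          (((L ∪ Q ∪ decidedM MVC M Q F ∪ heavySetM G p γ MVC M Q F) \ MVC F).card : ℝ)) ≤
      6 * ε * opt := by
  have hopt' : opt = ∑ v, probEvent p G.edgeFinset (fun F => v ∈ MVC F) := by
    rw [hopt, optVal, aux_card]
  rw [aux_card]
  have key : ∀ v : V, probEvent p G.edgeFinset (fun F => v ∈
      ((L ∪ Q ∪ decidedM MVC M Q F ∪ heavySetM G p γ MVC M Q F) \ MVC F)) ≤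
      5 * ε * probEvent p G.edgeFinset (fun F => v ∈ MVC F) + (if v ∈ Q then 1 else 0) := by
    intro v
    have hP0 := aux_nonneg p hp0 hp1 G.edgeFinset (fun F => v ∈ MVC F)
    have hc := aux_compl p G.edgeFinset (fun F => v ∈ MVC F)
    have h1 : probEvent p G.edgeFinset (fun F => v ∈
      ((L ∪ Q ∪ decidedM MVC M Q F ∪ heavySetM G p γ MVC M Q F) \ MVC F)) ≤
      probEvent p G.edgeFinset (fun F => ¬ v ∈ MVC F) :=
      aux_mono p hp0 hp1 _ _ _ fun F _ h => (Finset.mem_sdiff.1 h).2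
    have hεP := mul_nonneg hε0.le hP0
    by_cases hvQ : v ∈ Q
    · rw [if_pos hvQ]
      linarith
    rw [if_neg hvQ]
    by_cases hvL : v ∈ L
    · rw [hL, Finset.mem_filter] at hvL
      have := hvL.2
      nlinarith
    have h2 : probEvent p G.edgeFinset (fun F => v ∈
      ((L ∪ Q ∪ decidedM MVC M Q F ∪ heavySetM G p γ MVC M Q F) \ MVC F)) ≤
      probEvent p G.edgeFinset (fun F => v ∈ problematicM G p γ MVC M Q F) := by
      refine aux_mono p hp0 hp1 _ _ _ fun F hF h => ?_
      simp only [Finset.mem_sdiff, Finset.mem_union, hvL, hvQ, false_or] at h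
      obtain ⟨h | h, hn⟩ := h
      · exfalso
        obtain ⟨-, u, hu, huv⟩ := Finset.mem_filter.1 h
        obtain ⟨w, hw, hwe⟩ := (hMVC F hF).1 _ huv
        rcases Sym2.mem_iff.1 hwe with rfl | rfl
        · exact (Finset.mem_sdiff.1 hu).2 hw
        · exact hn hw
      · obtain ⟨ha, hb⟩ := Finset.mem_filter.1 h
        exact Finset.mem_filter.2 ⟨ha, hn, hb⟩
    by_cases hvM : v ∈ M
    · have h3 := hprob v (Finset.mem_sdiff.2 ⟨hvM, hvQ⟩)
      rw [hM, Finset.mem_filter] at hvM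
      have := hvM.2.1
      rw [hδ] at h3
      nlinarith
    · have h3 : probEvent p G.edgeFinset (fun F => v ∈ problematicM G p γ MVC M Q F) = 0 := by
        unfold probEvent
        refine Finset.sum_eq_zero fun F _ => if_neg fun h => ?_
        exact hvM (Finset.mem_sdiff.1 (Finset.mem_filter.1 h).1).1
      linarith
  refine (Finset.sum_le_sum fun v _ => key v).trans ?_
  rw [Finset.sum_add_distrib, ← Finset.mul_sum, ← hopt']
  have hq : (∑ v : V, if v ∈ Q then (1 : ℝ) else 0) = Q.card := by simp
  rw [hq]
  have hopt0 : 0 ≤ opt := by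
    rw [hopt']
    exact Finset.sum_nonneg fun v _ => aux_nonneg p hp0 hp1 _ _
  have : ε ^ 2 / 100 * opt ≤ ε * opt :=
    mul_le_mul_of_nonneg_right (by nlinarith) hopt0
  linarith
end
end

section
/- There exists an absolute constant K > 0 such that the following holds. For every finite simple graph G = (V,E) with |V| = n, every p ∈ (0,1], and every ε ∈ (0, 1/4) with opt ≥ K·log(1/ε)/ε², the minimum, over all sets S ⊆ V such that the induced subgraph G[V \ S] has at most 2·10³·n/(ε⁵·p) edges, of the quantity |S| + E[|MVC(G*[V \ S])|] is at most (1 + K·ε)·opt. -/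
open Finset

noncomputable section
open scoped Classical

variable {V : Type*} [Fintype V] [DecidableEq V]

set_option linter.unusedSectionVars false
set_option linter.unusedSimpArgs false

lemma sum_powerset_union_disj (A B : Finset (Sym2 V)) (h : Disjoint A B)
    (X : Finset (Sym2 V) → ℝ) :
    ∑ F ∈ (A ∪ B).powerset, X F = ∑ x ∈ A.powerset, ∑ y ∈ B.powerset, X (x ∪ y) := by
  rw [← Finset.sum_product']
  refine Finset.sum_nbij' (fun F => (F ∩ A, F ∩ B)) (fun z => z.1 ∪ z.2) ?_ ?_ ?_ ?_ ?_
  · intro F hF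
    simp
  · intro z hz
    simp only [mem_product, mem_powerset] at hz
    simp only [mem_powerset]
    exact union_subset_union hz.1 hz.2
  · intro F hF
    simp only [mem_powerset] at hF
    simp only
    rw [← inter_union_distrib_left]
    exact inter_eq_left.2 hF
  · rintro ⟨x, y⟩ hz
    simp only [mem_product, mem_powerset] at hz
    obtain ⟨h1, h2⟩ := hz
    rw [Finset.disjoint_left] at h
    ext e
    · simp only [mem_inter, mem_union]
      constructor
      · rintro ⟨h3 | h3, h4⟩
        · exact h3
        · exact absurd (h2 h3) (h h4)
      · intro h3
        exact ⟨Or.inl h3, h1 h3⟩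
    · simp only [mem_inter, mem_union]
      constructor
      · rintro ⟨h3 | h3, h4⟩
        · exact absurd h4 (h (h1 h3))
        · exact h3
      · intro h3
        exact ⟨Or.inr h3, h2 h3⟩
  · intro F hF
    simp only [mem_powerset] at hF
    simp only
    rw [← inter_union_distrib_left, inter_eq_left.2 hF]

lemma edgeWeight_union (p : ℝ) (A B x y : Finset (Sym2 V)) (h : Disjoint A B)
    (hx : x ⊆ A) (hy : y ⊆ B) :
    edgeWeight p (A ∪ B) (x ∪ y) = edgeWeight p A x * edgeWeight p B y := by
  have h1 : (x ∪ y).card = x.card + y.card :=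
    card_union_of_disjoint (disjoint_of_subset_left hx (disjoint_of_subset_right hy h))
  have h2 : ((A ∪ B) \ (x ∪ y)).card = (A \ x).card + (B \ y).card := by
    rw [← card_union_of_disjoint
      (disjoint_of_subset_left sdiff_subset (disjoint_of_subset_right sdiff_subset h))]
    congr 1
    rw [Finset.disjoint_left] at h
    ext e
    simp only [mem_sdiff, mem_union]
    have a1 := @hx e
    have a2 := @hy e
    have a3 := @h e
    tauto
  unfold edgeWeight
  rw [h1, h2, pow_add, pow_add]
  ring

lemma expVal_union (p : ℝ) (A B : Finset (Sym2 V)) (h : Disjoint A B)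
    (X : Finset (Sym2 V) → ℝ) :
    expVal p (A ∪ B) X = expVal p A (fun x => expVal p B (fun y => X (x ∪ y))) := by
  unfold expVal
  rw [sum_powerset_union_disj A B h]
  refine sum_congr rfl fun x hx => ?_
  rw [mul_sum]
  refine sum_congr rfl fun y hy => ?_
  rw [mem_powerset] at hx hy
  rw [edgeWeight_union p A B x y h hx hy]
  ring

lemma expVal_pow (p y : ℝ) (E : Finset (Sym2 V)) :
    expVal p E (fun F => y ^ F.card) = (p * y + (1 - p)) ^ E.card := by
  rw [← Finset.sum_pow_mul_eq_add_pow]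
  unfold expVal edgeWeight
  refine sum_congr rfl fun x hx => ?_
  rw [mem_powerset] at hx
  rw [card_sdiff_of_subset hx, mul_pow]
  ring

lemma expVal_const (p c : ℝ) (E : Finset (Sym2 V)) : expVal p E (fun _ => c) = c := by
  have h := expVal_pow p 1 E
  simp only [one_pow] at h
  have h2 : expVal p E (fun _ => c) = expVal p E (fun _ => 1) * c := by
    unfold expVal
    rw [sum_mul]
    simp
  rw [h2, h]
  simp

lemma edgeWeight_nonneg (p : ℝ) (h0 : 0 ≤ p) (h1 : p ≤ 1) (E F : Finset (Sym2 V)) :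
    0 ≤ edgeWeight p E F :=
  mul_nonneg (pow_nonneg h0 _) (pow_nonneg (by linarith) _)

lemma expVal_mono (p : ℝ) (h0 : 0 ≤ p) (h1 : p ≤ 1) (E : Finset (Sym2 V))
    (X Y : Finset (Sym2 V) → ℝ) (h : ∀ F ⊆ E, X F ≤ Y F) : expVal p E X ≤ expVal p E Y := by
  unfold expVal
  refine sum_le_sum fun F hF => ?_
  exact mul_le_mul_of_nonneg_left (h F (mem_powerset.1 hF)) (edgeWeight_nonneg p h0 h1 E F)

lemma expVal_congr (p : ℝ) (E : Finset (Sym2 V))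
    (X Y : Finset (Sym2 V) → ℝ) (h : ∀ F ⊆ E, X F = Y F) : expVal p E X = expVal p E Y := by
  unfold expVal
  refine sum_congr rfl fun F hF => ?_
  rw [h F (mem_powerset.1 hF)]

lemma expVal_add (p : ℝ) (E : Finset (Sym2 V)) (X Y : Finset (Sym2 V) → ℝ) :
    expVal p E (fun F => X F + Y F) = expVal p E X + expVal p E Y := by
  unfold expVal
  rw [← sum_add_distrib]
  exact sum_congr rfl fun F _ => by ring

lemma expVal_smul (p c : ℝ) (E : Finset (Sym2 V)) (X : Finset (Sym2 V) → ℝ) :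
    expVal p E (fun F => c * X F) = c * expVal p E X := by
  unfold expVal
  rw [mul_sum]
  exact sum_congr rfl fun F _ => by ring

lemma expVal_sum {ι : Type*} (p : ℝ) (E : Finset (Sym2 V)) (s : Finset ι)
    (X : ι → Finset (Sym2 V) → ℝ) :
    expVal p E (fun F => ∑ i ∈ s, X i F) = ∑ i ∈ s, expVal p E (X i) := by
  unfold expVal
  rw [sum_comm]
  exact sum_congr rfl fun F _ => by rw [mul_sum]

lemma expVal_sq_le (p : ℝ) (h0 : 0 ≤ p) (h1 : p ≤ 1) (E : Finset (Sym2 V))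
    (X : Finset (Sym2 V) → ℝ) : (expVal p E X) ^ 2 ≤ expVal p E (fun F => X F ^ 2) := by
  set m := expVal p E X with hm
  have h : expVal p E (fun F => 2 * m * X F + (- m ^ 2)) ≤ expVal p E (fun F => X F ^ 2) :=
    expVal_mono p h0 h1 E _ _ fun F _ => by nlinarith [sq_nonneg (X F - m)]
  rw [expVal_add, expVal_smul, expVal_const, ← hm] at h
  nlinarith

/-- probability of an event -/
def prE (p : ℝ) (E : Finset (Sym2 V)) (A : Finset (Sym2 V) → Prop) : ℝ :=
  expVal p E (fun F => if A F then 1 else 0)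

lemma prE_mono (p : ℝ) (h0 : 0 ≤ p) (h1 : p ≤ 1) (E : Finset (Sym2 V))
    (A B : Finset (Sym2 V) → Prop) (h : ∀ F ⊆ E, A F → B F) : prE p E A ≤ prE p E B := by
  refine expVal_mono p h0 h1 E _ _ fun F hF => ?_
  by_cases hA : A F
  · simp [hA, h F hF hA]
  · simp only [hA, if_false]
    split_ifs <;> norm_num

lemma prE_or (p : ℝ) (h0 : 0 ≤ p) (h1 : p ≤ 1) (E : Finset (Sym2 V))
    (A B : Finset (Sym2 V) → Prop) : prE p E (fun F => A F ∨ B F) ≤ prE p E A + prE p E B := by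
  unfold prE
  rw [← expVal_add]
  refine expVal_mono p h0 h1 E _ _ fun F hF => ?_
  by_cases hA : A F <;> by_cases hB : B F <;> simp [hA, hB]

lemma prE_exists {ι : Type*} (p : ℝ) (h0 : 0 ≤ p) (h1 : p ≤ 1) (E : Finset (Sym2 V))
    (s : Finset ι) (A : ι → Finset (Sym2 V) → Prop) :
    prE p E (fun F => ∃ i ∈ s, A i F) ≤ ∑ i ∈ s, prE p E (A i) := by
  unfold prE
  rw [← expVal_sum]
  refine expVal_mono p h0 h1 E _ _ fun F hF => ?_
  have hnn : ∀ i ∈ s, (0:ℝ) ≤ if A i F then 1 else 0 := fun i _ => by split_ifs <;> norm_num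
  split_ifs with h
  · obtain ⟨i, hi, hA⟩ := h
    have := single_le_sum hnn hi
    simpa [hA] using this
  · exact sum_nonneg hnn

lemma prE_markov (p : ℝ) (h0 : 0 ≤ p) (h1 : p ≤ 1) (E : Finset (Sym2 V))
    (X : Finset (Sym2 V) → ℝ) (hX : ∀ F ⊆ E, 0 ≤ X F) (t : ℝ) :
    t * prE p E (fun F => t ≤ X F) ≤ expVal p E X := by
  unfold prE
  rw [← expVal_smul]
  refine expVal_mono p h0 h1 E _ _ fun F hF => ?_
  split_ifs with h
  · linarith
  · simpa using hX F hF

lemma prE_not (p : ℝ) (E : Finset (Sym2 V))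
    (A : Finset (Sym2 V) → Prop) : prE p E A + prE p E (fun F => ¬ A F) = 1 := by
  unfold prE
  rw [← expVal_add]
  refine Eq.trans ?_ (expVal_const p 1 E)
  refine expVal_congr p E _ _ fun F _ => ?_
  by_cases hA : A F <;> simp [hA]

lemma expVal_marg (p : ℝ) (A E : Finset (Sym2 V)) (hA : A ⊆ E) (X : Finset (Sym2 V) → ℝ)
    (h : ∀ x ⊆ E, X x = X (x \ A)) : expVal p E X = expVal p (E \ A) X := by
  have e : E = A ∪ (E \ A) := by rw [union_sdiff_of_subset hA]
  have hd : Disjoint A (E \ A) := disjoint_sdiff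
  have : expVal p E X = expVal p A (fun x => expVal p (E \ A) X) := by
    conv_lhs => rw [e, expVal_union p A (E \ A) hd]
    refine expVal_congr p A _ _ fun x hx => ?_
    refine expVal_congr p _ _ _ fun y hy => ?_
    have hxy : x ∪ y ⊆ E := union_subset (hx.trans hA) (hy.trans sdiff_subset)
    rw [h _ hxy, h y (hy.trans sdiff_subset)]
    congr 1
    ext z
    have := @hx z
    simp only [mem_sdiff, mem_union]
    tauto
  rw [this, expVal_const]

lemma prE_decouple (p : ℝ) (h0 : 0 ≤ p) (h1 : p ≤ 1) (A E : Finset (Sym2 V)) (hA : A ⊆ E)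
    (Ev : Finset (Sym2 V) → Finset (Sym2 V) → Prop) (β : ℝ)
    (h : ∀ x1 ⊆ A, ∀ x ⊆ E, Ev x1 x ↔ Ev x1 (x \ A))
    (hb : ∀ x1 ⊆ A, prE p E (Ev x1) ≤ β) :
    prE p E (fun x => Ev (x ∩ A) x) ≤ β := by
  have e : E = A ∪ (E \ A) := by rw [union_sdiff_of_subset hA]
  have hd : Disjoint A (E \ A) := disjoint_sdiff
  have : prE p E (fun x => Ev (x ∩ A) x) =
      expVal p A (fun x1 => prE p (E \ A) (Ev x1)) := by
    unfold prE
    conv_lhs => rw [e, expVal_union p A (E \ A) hd]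
    refine expVal_congr p A _ _ fun x hx => ?_
    refine expVal_congr p _ _ _ fun y hy => ?_
    have hxy : x ∪ y ⊆ E := union_subset (hx.trans hA) (hy.trans sdiff_subset)
    have e1 : (x ∪ y) ∩ A = x := by
      ext z
      have := @hx z
      have := @hy z
      simp only [mem_inter, mem_union, mem_sdiff] at *
      tauto
    have e2 : (x ∪ y) \ A = y \ A := by
      ext z
      have := @hx z
      have := @hy z
      simp only [mem_inter, mem_union, mem_sdiff] at *
      tauto
    simp only [e1]
    have : Ev x (x ∪ y) ↔ Ev x y := by
      rw [h x hx _ hxy, h x hx y (hy.trans sdiff_subset), e2]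
    simp [this]
  rw [this]
  calc _ ≤ expVal p A (fun _ => β) := by
        refine expVal_mono p h0 h1 A _ _ fun x1 hx1 => ?_
        refine le_trans (le_of_eq ?_) (hb x1 hx1)
        unfold prE
        rw [expVal_marg p A E hA]
        intro x hx
        simp only [h x1 hx1 x hx]
    _ = β := expVal_const _ _ _

/-- Chernoff type bound -/
lemma prE_chernoff (p : ℝ) (h0 : 0 ≤ p) (h1 : p ≤ 1) (A E : Finset (Sym2 V)) (hA : A ⊆ E)
    (t : ℝ) :
    prE p E (fun x => ((x ∩ A).card : ℝ) ≤ t) ≤ Real.exp (t - p * A.card / 2) := by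
  have e : (E \ A) ∪ A = E := by rw [sdiff_union_of_subset hA]
  have hd : Disjoint (E \ A) A := sdiff_disjoint
  set y := Real.exp (-1) with hy
  have hy0 : 0 < y := Real.exp_pos _
  have hy2 : y ≤ 1 / 2 := by
    rw [hy, Real.exp_neg, one_div]
    apply inv_anti₀ (by norm_num)
    have := Real.add_one_le_exp (1:ℝ)
    linarith
  have key : expVal p E (fun x => y ^ (x ∩ A).card) = (p * y + (1 - p)) ^ A.card := by
    conv_lhs => rw [← e, expVal_union p _ _ hd]
    rw [← expVal_pow, ← expVal_const p (expVal p A _) (E \ A)]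
    refine expVal_congr p _ _ _ fun x hx => ?_
    refine expVal_congr p _ _ _ fun z hz => ?_
    congr 2
    ext w
    have := @hx w
    have := @hz w
    simp only [mem_inter, mem_union, mem_sdiff] at *
    tauto
  have s1 : prE p E (fun x => ((x ∩ A).card : ℝ) ≤ t) ≤
      Real.exp t * expVal p E (fun x => y ^ (x ∩ A).card) := by
    unfold prE
    rw [← expVal_smul]
    refine expVal_mono p h0 h1 E _ _ fun x hx => ?_
    split_ifs with h
    · rw [hy, ← Real.exp_nat_mul, ← Real.exp_add]
      apply Real.one_le_exp
      linarith
    · positivity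
  refine s1.trans ?_
  rw [key, sub_eq_add_neg t, Real.exp_add]
  apply mul_le_mul_of_nonneg_left _ (Real.exp_pos _).le
  have : -(p * A.card / 2) = A.card * (-(p/2)) := by ring
  rw [this, Real.exp_nat_mul]
  apply pow_le_pow_left₀
  · nlinarith
  · have := Real.add_one_le_exp (-(p/2))
    nlinarith

lemma conc_one (p μ : ℝ) (h0 : 0 ≤ p) (h1 : p ≤ 1) (hμ : 0 ≤ μ) (A : Finset (Sym2 V))
    (f c g : Finset (Sym2 V) → ℝ) (hc : ∀ x ⊆ A, 0 ≤ c x)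
    (h : ∀ x ⊆ A, ∀ y ⊆ A, f x ≤ g y + c x * (if x ≠ y then 1 else 0)) :
    expVal p A (fun y => Real.exp (-μ * g y)) ≤
      Real.exp (-μ * expVal p A f + μ ^ 2 / 2 * expVal p A (fun x => c x ^ 2)) := by
  obtain ⟨z, hz, hmin⟩ := exists_min_image A.powerset g ⟨∅, by simp⟩
  set m := g z with hm
  rw [mem_powerset] at hz
  have pt : ∀ x ⊆ A, Real.exp (-μ * g x) ≤
      Real.exp (-μ * m) * ((1 + μ * m) + (-μ * f x + μ ^ 2 / 2 * c x ^ 2)) := by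
    intro x hx
    have a1 : f x ≤ g x := by simpa using h x hx x hx
    have a2 : f x ≤ m + c x := by
      have := h x hx z hz
      have hc' := hc x hx
      split_ifs at this <;> linarith
    have a3 : m ≤ g x := hmin x (mem_powerset.2 hx)
    have e : -μ * g x = -μ * m + -(μ * (g x - m)) := by ring
    rw [e, Real.exp_add]
    apply mul_le_mul_of_nonneg_left _ (Real.exp_pos _).le
    by_cases hf : f x ≤ m
    · have : Real.exp (-(μ * (g x - m))) ≤ 1 := by
        apply Real.exp_le_one_iff.2
        have := mul_nonneg hμ (sub_nonneg.2 a3)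
        linarith
      have := mul_nonneg hμ (sub_nonneg.2 hf)
      have : 0 ≤ μ ^ 2 / 2 * c x ^ 2 := by positivity
      nlinarith
    · push Not at hf
      set u := μ * (f x - m) with hu
      have hu0 : 0 ≤ u := mul_nonneg hμ (by linarith)
      have b1 : Real.exp (-(μ * (g x - m))) ≤ Real.exp (-u) := by
        apply Real.exp_le_exp.2
        have := mul_le_mul_of_nonneg_left a1 hμ
        nlinarith
      have b2 : Real.exp (-u) ≤ 1 - u + u ^ 2 / 2 := by
        have q := Real.quadratic_le_exp_of_nonneg hu0
        rw [Real.exp_neg]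
        have hp : 0 < 1 + u + u ^ 2 / 2 := by positivity
        have : (Real.exp u)⁻¹ ≤ (1 + u + u ^ 2 / 2)⁻¹ := inv_anti₀ hp q
        refine this.trans ?_
        rw [inv_le_iff_one_le_mul₀ hp]
        nlinarith [pow_nonneg hu0 4]
      have b3 : u ^ 2 ≤ μ ^ 2 * c x ^ 2 := by
        rw [← mul_pow]
        apply pow_le_pow_left₀ hu0
        exact mul_le_mul_of_nonneg_left (by linarith) hμ
      nlinarith
  refine (expVal_mono p h0 h1 A _ _ pt).trans ?_
  rw [expVal_smul, expVal_add, expVal_const, expVal_add, expVal_smul, expVal_smul]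
  set T := -μ * expVal p A f + μ ^ 2 / 2 * expVal p A (fun x => c x ^ 2)
  have : Real.exp T = Real.exp (-μ * m) * Real.exp (T + μ * m) := by
    rw [← Real.exp_add]; congr 1; ring
  rw [this]
  apply mul_le_mul_of_nonneg_left _ (Real.exp_pos _).le
  have := Real.add_one_le_exp (T + μ * m)
  linarith

lemma conc_blocks {ι : Type*} [DecidableEq ι] (p μ : ℝ) (h0 : 0 ≤ p) (h1 : p ≤ 1) (hμ : 0 < μ)
    (Bk : ι → Finset (Sym2 V)) (hB : ∀ i j, i ≠ j → Disjoint (Bk i) (Bk j)) (s : Finset ι) :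
    ∀ (f g : Finset (Sym2 V) → ℝ) (c : ι → Finset (Sym2 V) → ℝ),
    (∀ i ∈ s, ∀ x ⊆ s.biUnion Bk, 0 ≤ c i x) →
    (∀ x ⊆ s.biUnion Bk, ∀ y ⊆ s.biUnion Bk,
      f x ≤ g y + ∑ i ∈ s, c i x * (if x ∩ Bk i ≠ y ∩ Bk i then 1 else 0)) →
    expVal p (s.biUnion Bk) (fun y => Real.exp (-μ * g y)) ≤
      Real.exp (-μ * expVal p (s.biUnion Bk) f +
        μ ^ 2 / 2 * ∑ i ∈ s, expVal p (s.biUnion Bk) (fun x => c i x ^ 2)) := by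
  induction s using Finset.induction_on with
  | empty =>
    intro f g c _ h
    have := h ∅ (by simp) ∅ (by simp)
    simp only [sum_empty, add_zero] at this
    simp only [biUnion_empty, expVal, powerset_empty, sum_singleton, edgeWeight, card_empty,
      pow_zero, sdiff_self, one_mul, sum_empty, mul_zero, add_zero]
    simp only [Finset.bot_eq_empty, card_empty, pow_zero, one_mul]
    apply Real.exp_le_exp.2
    nlinarith
  | insert a s ha ih =>
    intro f g c hc h
    rw [biUnion_insert] at hc h ⊢
    set R := s.biUnion Bk with hR
    have hd : Disjoint (Bk a) R := by
      rw [hR, disjoint_biUnion_right]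
      intro i hi
      exact hB a i (fun e => ha (e ▸ hi))
    simp only [expVal_union p _ _ hd]
    set Gf : Finset (Sym2 V) → ℝ := fun y1 =>
      -(1/μ) * Real.log (expVal p R (fun y2 => Real.exp (-μ * g (y1 ∪ y2)))) with hGf
    set Ff : Finset (Sym2 V) → ℝ := fun x1 =>
      expVal p R (fun x2 => f (x1 ∪ x2)) +
        (-(μ / 2)) * ∑ i ∈ s, expVal p R (fun x2 => c i (x1 ∪ x2) ^ 2) with hFf
    set Cf : Finset (Sym2 V) → ℝ := fun x1 => expVal p R (fun x2 => c a (x1 ∪ x2)) with hCf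
    have hpos : ∀ y1, 0 < expVal p R (fun y2 => Real.exp (-μ * g (y1 ∪ y2))) := by
      intro y1
      obtain ⟨z, hz, hmin⟩ := exists_min_image R.powerset
        (fun y2 => Real.exp (-μ * g (y1 ∪ y2))) ⟨∅, by simp⟩
      calc 0 < Real.exp (-μ * g (y1 ∪ z)) := Real.exp_pos _
        _ = expVal p R (fun _ => Real.exp (-μ * g (y1 ∪ z))) := (expVal_const _ _ _).symm
        _ ≤ _ := expVal_mono p h0 h1 R _ _ fun F hF => hmin F (mem_powerset.2 hF)
    have hexpG : ∀ y1, Real.exp (-μ * Gf y1) =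
        expVal p R (fun y2 => Real.exp (-μ * g (y1 ∪ y2))) := by
      intro y1
      have : -μ * Gf y1 = Real.log (expVal p R (fun y2 => Real.exp (-μ * g (y1 ∪ y2)))) := by
        rw [hGf]; field_simp
      rw [this, Real.exp_log (hpos y1)]
    have step : ∀ x ⊆ Bk a, ∀ y ⊆ Bk a, Ff x ≤ Gf y + Cf x * (if x ≠ y then 1 else 0) := by
      intro x1 hx1 y1 hy1
      have I := ih (fun x2 => f (x1 ∪ x2) + (-(if x1 ≠ y1 then 1 else 0)) * c a (x1 ∪ x2))
        (fun y2 => g (y1 ∪ y2)) (fun i x2 => c i (x1 ∪ x2))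
        (fun i hi x2 hx2 => hc i (mem_insert_of_mem hi) _ (union_subset_union hx1 hx2)) ?_
      · rw [expVal_add, expVal_smul, ← hexpG, Real.exp_le_exp] at I
        simp only [hFf, hCf]
        apply le_of_mul_le_mul_left _ hμ
        nlinarith
      · intro x2 hx2 y2 hy2
        have H := h (x1 ∪ x2) (union_subset_union hx1 hx2) (y1 ∪ y2) (union_subset_union hy1 hy2)
        rw [sum_insert ha] at H
        have aux : ∀ u1 ⊆ Bk a, ∀ u2 ⊆ R, (u1 ∪ u2) ∩ Bk a = u1 := by
          intro u1 hu1 u2 hu2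
          rw [Finset.disjoint_left] at hd
          ext w
          have := @hu1 w
          have := @hu2 w
          have := @hd w
          simp only [mem_inter, mem_union]
          tauto
        have aux2 : ∀ u1 ⊆ Bk a, ∀ u2 ⊆ R, ∀ i ∈ s, (u1 ∪ u2) ∩ Bk i = u2 ∩ Bk i := by
          intro u1 hu1 u2 hu2 i hi
          have hdi := hB a i (fun e => ha (e ▸ hi))
          rw [Finset.disjoint_left] at hdi
          ext w
          have := @hu1 w
          have := @hdi w
          simp only [mem_inter, mem_union]
          tauto
        rw [aux x1 hx1 x2 hx2, aux y1 hy1 y2 hy2] at H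
        have e : ∑ i ∈ s, c i (x1 ∪ x2) *
            (if (x1 ∪ x2) ∩ Bk i ≠ (y1 ∪ y2) ∩ Bk i then (1:ℝ) else 0) =
            ∑ i ∈ s, c i (x1 ∪ x2) * (if x2 ∩ Bk i ≠ y2 ∩ Bk i then (1:ℝ) else 0) := by
          refine sum_congr rfl fun i hi => ?_
          rw [aux2 x1 hx1 x2 hx2 i hi, aux2 y1 hy1 y2 hy2 i hi]
        rw [e] at H
        nlinarith
    have J := conc_one p μ h0 h1 hμ.le (Bk a) Ff Cf Gf ?_ step
    · simp only [hexpG] at J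
      refine J.trans (Real.exp_le_exp.2 ?_)
      have e1 : expVal p (Bk a) Ff = expVal p (Bk a) (fun x1 => expVal p R (fun x2 => f (x1 ∪ x2)))
          + (-(μ/2)) * ∑ i ∈ s, expVal p (Bk a)
            (fun x1 => expVal p R (fun x2 => c i (x1 ∪ x2) ^ 2)) := by
        rw [hFf, expVal_add, expVal_smul, expVal_sum]
      have e2 : expVal p (Bk a) (fun x1 => Cf x1 ^ 2) ≤
          expVal p (Bk a) (fun x1 => expVal p R (fun x2 => c a (x1 ∪ x2) ^ 2)) :=
        expVal_mono p h0 h1 _ _ _ fun x1 _ => expVal_sq_le p h0 h1 R _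
      rw [e1, sum_insert ha]
      have := mul_le_mul_of_nonneg_left e2 (by positivity : 0 ≤ μ ^ 2 / 2)
      nlinarith
    · intro x1 hx1
      rw [hCf]
      have : expVal p R (fun _ => 0) ≤ expVal p R (fun x2 => c a (x1 ∪ x2)) :=
        expVal_mono p h0 h1 R _ _ fun x2 hx2 =>
          hc a (mem_insert_self _ _) _ (union_subset_union hx1 hx2)
      rwa [expVal_const] at this

/-- vertex cover number -/
def tau (x : Finset (Sym2 V)) : ℕ := sInf {n | ∃ C : Finset V, IsCoverOf C x ∧ C.card = n}

lemma cover_univ (x : Finset (Sym2 V)) : IsCoverOf (univ : Finset V) x := by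
  intro e _
  exact ⟨_, mem_univ _, Sym2.out_fst_mem e⟩

lemma tau_spec (x : Finset (Sym2 V)) : ∃ C : Finset V, IsCoverOf C x ∧ C.card = tau x :=
  Nat.sInf_mem (s := {n | ∃ C : Finset V, IsCoverOf C x ∧ C.card = n})
    ⟨_, univ, cover_univ x, rfl⟩

lemma tau_le (x : Finset (Sym2 V)) (C : Finset V) (h : IsCoverOf C x) : tau x ≤ C.card :=
  Nat.sInf_le ⟨C, h, rfl⟩

lemma tau_mono (x y : Finset (Sym2 V)) (h : x ⊆ y) : tau x ≤ tau y := by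
  obtain ⟨C, hC, hc⟩ := tau_spec y
  rw [← hc]
  exact tau_le x C fun e he => hC e (h he)

lemma mvc_card (E : Finset (Sym2 V)) (MVC : Finset (Sym2 V) → Finset V)
    (h : IsMinCoverFn E MVC) (x : Finset (Sym2 V)) (hx : x ⊆ E) : (MVC x).card = tau x := by
  obtain ⟨h1, h2⟩ := h x hx
  obtain ⟨C, hC, hc⟩ := tau_spec x
  exact le_antisymm (hc ▸ h2 C hC) (tau_le x _ h1)

lemma kernel_exists (x : Finset (Sym2 V)) :
    ∃ U : Finset V, tau x ≤ tau (x.filter fun e => ∀ v ∈ e, v ∈ U) ∧ U.card ≤ 2 * tau x := by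
  have hne : ((univ : Finset (Finset V)).filter
      fun U => tau x ≤ tau (x.filter fun e => ∀ v ∈ e, v ∈ U)).Nonempty :=
    ⟨univ, by simp⟩
  obtain ⟨U, hU, hmin⟩ := exists_min_image _ card hne
  simp only [mem_filter, mem_univ, true_and] at hU hmin
  refine ⟨U, hU, ?_⟩
  set y := x.filter fun e => ∀ v ∈ e, v ∈ U with hy
  have hyx : tau y ≤ tau x := tau_mono _ _ (filter_subset _ _)
  have hD : ∀ v ∈ U, ∃ D : Finset V, IsCoverOf D y ∧ v ∈ D ∧ D.card ≤ tau x := by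
    intro v hv
    have : tau (x.filter fun e => ∀ w ∈ e, w ∈ U.erase v) < tau x := by
      by_contra hcon
      push Not at hcon
      have := hmin _ hcon
      have := card_erase_lt_of_mem hv
      omega
    obtain ⟨D, hD, hc⟩ := tau_spec (x.filter fun e => ∀ w ∈ e, w ∈ U.erase v)
    refine ⟨insert v D, ?_, mem_insert_self _ _, ?_⟩
    · intro e he
      rw [hy, mem_filter] at he
      by_cases hve : v ∈ e
      · exact ⟨v, mem_insert_self _ _, hve⟩
      · obtain ⟨w, hw, hwe⟩ := hD e (by
          rw [mem_filter]
          refine ⟨he.1, fun w hw => mem_erase.2 ⟨?_, he.2 w hw⟩⟩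
          rintro rfl
          exact hve hw)
        exact ⟨w, mem_insert_of_mem hw, hwe⟩
    · have := card_insert_le v D
      omega
  by_contra hbig
  push Not at hbig
  obtain ⟨C, hC, hCc⟩ := tau_spec y
  set I := U \ C with hI
  have hIc : C.card < I.card := by
    have := le_card_sdiff C U
    rw [hI]
    omega
  set N : Finset V → Finset V := fun B => C.filter fun w => ∃ b ∈ B, s(b, w) ∈ y with hN
  obtain ⟨B, hB, hBmin⟩ := exists_min_image
    (I.powerset.filter fun B => (N B).card < B.card) card ⟨I, by
      simp only [mem_filter, mem_powerset, subset_refl, true_and]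
      exact lt_of_le_of_lt (card_le_card (filter_subset _ _)) hIc⟩
  simp only [mem_filter, mem_powerset] at hB hBmin
  obtain ⟨hBI, hBv⟩ := hB
  have hBC : ∀ b ∈ B, b ∉ C := fun b hb => (mem_sdiff.1 (hBI hb)).2
  obtain ⟨v, hv⟩ : B.Nonempty := by
    rw [← card_pos]; omega
  obtain ⟨D, hDc, hvD, hDt⟩ := hD v (mem_sdiff.1 (hBI hv)).1
  have hnb : ∀ b ∈ B, ∀ e ∈ y, b ∈ e → ∃ w ∈ N B, w ∈ e := by
    intro b hb e he hbe
    obtain ⟨w, hw, hwe⟩ := hC e he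
    refine ⟨w, ?_, hwe⟩
    have hbw : b ≠ w := by
      rintro rfl
      exact hBC b hb hw
    have : e = s(b, w) := ((Sym2.mem_and_mem_iff hbw).1 ⟨hbe, hwe⟩)
    rw [hN]
    exact mem_filter.2 ⟨hw, b, hb, this ▸ he⟩
  have hcov : IsCoverOf ((D \ B) ∪ (N B \ D)) y := by
    intro e he
    obtain ⟨d, hd, hde⟩ := hDc e he
    by_cases hdB : d ∈ B
    · obtain ⟨w, hw, hwe⟩ := hnb d hdB e he hde
      refine ⟨w, ?_, hwe⟩
      have : w ∉ B := fun h => hBC w h (mem_filter.1 hw).1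
      simp only [mem_union, mem_sdiff]
      tauto
    · exact ⟨d, mem_union_left _ (mem_sdiff.2 ⟨hd, hdB⟩), hde⟩
  have c1 := tau_le _ _ hcov
  have c2 := card_union_le (D \ B) (N B \ D)
  have c3 : (D \ B).card + (D ∩ B).card = D.card := card_sdiff_add_card_inter D B
  have c4 : (N B \ D).card + (N B ∩ D).card = (N B).card := card_sdiff_add_card_inter _ _
  have c5 : (B \ D).card + (B ∩ D).card = B.card := card_sdiff_add_card_inter B D
  have c6 : (B ∩ D).card = (D ∩ B).card := by rw [inter_comm]
  have c7 : 0 < (B ∩ D).card := card_pos.2 ⟨v, mem_inter.2 ⟨hv, hvD⟩⟩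
  have c8 : (B \ D).card ≤ (N (B \ D)).card := by
    by_contra hcon
    push Not at hcon
    have := hBmin (B \ D) ⟨sdiff_subset.trans hBI, hcon⟩
    omega
  have c9 : (N (B \ D)).card ≤ (N B ∩ D).card := by
    apply card_le_card
    intro w hw
    rw [hN, mem_filter] at hw
    obtain ⟨hwC, b, hb, hbw⟩ := hw
    rw [mem_sdiff] at hb
    rw [mem_inter]
    refine ⟨mem_filter.2 ⟨hwC, b, hb.1, hbw⟩, ?_⟩
    obtain ⟨d, hd, hde⟩ := hDc _ hbw
    rcases Sym2.mem_iff.1 hde with h | h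
    · exact absurd (h ▸ hd) hb.2
    · exact h ▸ hd
  omega

/-- restriction of an edge set to the complement of `S` -/
def rst (S : Finset V) (x : Finset (Sym2 V)) : Finset (Sym2 V) :=
  x.filter fun e => ∀ v ∈ e, v ∉ S

lemma conc_tau (p μ : ℝ) (h0 : 0 ≤ p) (h1 : p ≤ 1) (hμ : 0 < μ) (E : Finset (Sym2 V))
    (S : Finset V) :
    expVal p E (fun x => Real.exp (-μ * (tau (rst S x) : ℝ))) ≤
      Real.exp (-μ * expVal p E (fun x => (tau (rst S x) : ℝ)) +
        μ ^ 2 * expVal p E (fun x => (tau (rst S x) : ℝ))) := by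
  set own : Sym2 V → V := fun e => (Quot.out e).1 with hown
  have ownm : ∀ e, own e ∈ e := fun e => Sym2.out_fst_mem e
  set Bk : V → Finset (Sym2 V) := fun v => E.filter fun e => own e = v with hBk
  have hBd : ∀ i j, i ≠ j → Disjoint (Bk i) (Bk j) := by
    intro i j hij
    rw [Finset.disjoint_left]
    intro e h1 h2
    rw [hBk, mem_filter] at h1 h2
    exact hij (h1.2.symm.trans h2.2)
  have hE : univ.biUnion Bk = E := by
    ext e
    simp [hBk]
  choose U hU1 hU2 using fun x : Finset (Sym2 V) => kernel_exists (rst S x)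
  have key := conc_blocks p μ h0 h1 hμ Bk hBd univ
    (fun x => (tau (rst S x) : ℝ)) (fun x => (tau (rst S x) : ℝ))
    (fun v x => if v ∈ U x then 1 else 0)
    (fun i _ x _ => by split_ifs <;> norm_num) ?_
  · rw [hE] at key
    refine key.trans (Real.exp_le_exp.2 ?_)
    rw [← expVal_sum]
    have : expVal p E (fun x => ∑ i, (if i ∈ U x then (1:ℝ) else 0) ^ 2) ≤
        expVal p E (fun x => 2 * (tau (rst S x) : ℝ)) := by
      refine expVal_mono p h0 h1 E _ _ fun x _ => ?_
      have e : ∑ i, (if i ∈ U x then (1:ℝ) else 0) ^ 2 = (U x).card := by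
        simp [ite_pow]
      rw [e]
      exact_mod_cast hU2 x
    rw [expVal_smul] at this
    have := mul_le_mul_of_nonneg_left this (by positivity : 0 ≤ μ ^ 2 / 2)
    nlinarith
  · rw [hE]
    intro x hx y hy
    obtain ⟨C, hC, hCc⟩ := tau_spec (rst S y)
    set Df := (U x).filter fun v => x ∩ Bk v ≠ y ∩ Bk v with hDf
    have hcov : IsCoverOf (C ∪ Df) ((rst S x).filter fun e => ∀ v ∈ e, v ∈ U x) := by
      intro e he
      rw [mem_filter, rst, mem_filter] at he
      by_cases hxy : x ∩ Bk (own e) = y ∩ Bk (own e)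
      · have : e ∈ y ∩ Bk (own e) := by
          rw [← hxy, mem_inter, hBk, mem_filter]
          exact ⟨he.1.1, hx he.1.1, rfl⟩
        obtain ⟨v, hv, hve⟩ := hC e (mem_filter.2 ⟨(mem_inter.1 this).1, he.1.2⟩)
        exact ⟨v, mem_union_left _ hv, hve⟩
      · exact ⟨own e, mem_union_right _ (mem_filter.2 ⟨he.2 _ (ownm e), hxy⟩), ownm e⟩
    have c1 := (hU1 x).trans ((tau_le _ _ hcov).trans (card_union_le _ _))
    have e : ∑ i, (if i ∈ U x then (1:ℝ) else 0) * (if x ∩ Bk i ≠ y ∩ Bk i then 1 else 0)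
        = Df.card := by
      rw [hDf, card_filter, Nat.cast_sum, ← sum_filter_add_sum_filter_not univ (· ∈ U x)]
      have z1 : ∑ i ∈ univ.filter (fun i => i ∉ U x), (if i ∈ U x then (1:ℝ) else 0) *
          (if x ∩ Bk i ≠ y ∩ Bk i then 1 else 0) = 0 := by
        refine sum_eq_zero fun i hi => ?_
        rw [mem_filter] at hi
        simp [hi.2]
      rw [z1, add_zero]
      have : univ.filter (· ∈ U x) = U x := by ext; simp
      rw [this]
      refine sum_congr rfl fun i hi => ?_
      simp [hi]
    rw [e, ← hCc]
    exact_mod_cast c1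

lemma lower_tail (p : ℝ) (h0 : 0 ≤ p) (h1 : p ≤ 1) (E : Finset (Sym2 V))
    (S : Finset V) (M s b : ℝ) (hM : 0 < M) (hs : 0 < s)
    (hm : expVal p E (fun x => (tau (rst S x) : ℝ)) ≤ M)
    (hb : b ≤ expVal p E (fun x => (tau (rst S x) : ℝ)) - s) :
    prE p E (fun x => (tau (rst S x) : ℝ) ≤ b) ≤ Real.exp (-(s ^ 2 / (4 * M))) := by
  set m := expVal p E (fun x => (tau (rst S x) : ℝ)) with hmdef
  set μ := s / (2 * M) with hμdef
  have hμ : 0 < μ := by positivity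
  have k := conc_tau p μ h0 h1 hμ E S
  have s1 : prE p E (fun x => (tau (rst S x) : ℝ) ≤ b) ≤
      Real.exp (μ * b) * expVal p E (fun x => Real.exp (-μ * (tau (rst S x) : ℝ))) := by
    unfold prE
    rw [← expVal_smul]
    refine expVal_mono p h0 h1 E _ _ fun x hx => ?_
    split_ifs with h
    · rw [← Real.exp_add]
      apply Real.one_le_exp
      have := mul_le_mul_of_nonneg_left h hμ.le
      linarith
    · positivity
  refine s1.trans ((mul_le_mul_of_nonneg_left k (Real.exp_pos _).le).trans ?_)
  rw [← Real.exp_add, ← hmdef]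
  apply Real.exp_le_exp.2
  have t1 := mul_le_mul_of_nonneg_left hb hμ.le
  have t2 := mul_le_mul_of_nonneg_left hm (sq_nonneg μ)
  have t3 : μ ^ 2 * M - μ * s = -(s ^ 2 / (4 * M)) := by
    rw [hμdef]; field_simp; ring
  linarith

/-- neighbourhood of `F` in `x` -/
def nbr (x : Finset (Sym2 V)) (F : Finset V) : Finset V :=
  univ.filter fun w => ∃ u ∈ F, s(u, w) ∈ x

/-- edges touching `F` -/
def tch (E : Finset (Sym2 V)) (F : Finset V) : Finset (Sym2 V) :=
  E.filter fun e => ∃ u ∈ F, u ∈ e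

/-- the remaining vertices -/
def wst (F : Finset V) (x : Finset (Sym2 V)) : Finset V := univ \ (F ∪ nbr x F)

/-- edges at `v` inside `W` -/
def inc (E : Finset (Sym2 V)) (W : Finset V) (v : V) : Finset (Sym2 V) :=
  E.filter fun e => v ∈ e ∧ ∀ u ∈ e, u ∈ W

/-- high degree vertices -/
def tst (E : Finset (Sym2 V)) (B : Finset V) (d : ℝ) (F : Finset V) (x : Finset (Sym2 V)) :
    Finset V :=
  (B ∩ wst F x).filter fun v => d < ((inc E (wst F x) v).card : ℝ)

/-- the container complement -/
def sst (E : Finset (Sym2 V)) (B : Finset V) (d : ℝ) (F : Finset V) (x : Finset (Sym2 V)) :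
    Finset V := (F ∪ nbr x F) ∪ tst E B d F x

/-- edges inside `W` touching `R` -/
def edg (E : Finset (Sym2 V)) (W R : Finset V) : Finset (Sym2 V) :=
  E.filter fun e => (∃ v ∈ R, v ∈ e) ∧ ∀ u ∈ e, u ∈ W

lemma nbr_inter (E x : Finset (Sym2 V)) (F : Finset V) (hx : x ⊆ E) :
    nbr (x ∩ tch E F) F = nbr x F := by
  ext w
  simp only [nbr, mem_filter, mem_univ, true_and, mem_inter, tch]
  constructor
  · rintro ⟨u, hu, h, _⟩
    exact ⟨u, hu, h⟩
  · rintro ⟨u, hu, h⟩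
    exact ⟨u, hu, h, hx h, u, hu, Sym2.mem_mk_left _ _⟩

lemma wst_inter (E x : Finset (Sym2 V)) (F : Finset V) (hx : x ⊆ E) :
    wst F (x ∩ tch E F) = wst F x := by
  unfold wst; rw [nbr_inter E x F hx]

lemma tst_inter (E x : Finset (Sym2 V)) (B : Finset V) (d : ℝ) (F : Finset V) (hx : x ⊆ E) :
    tst E B d F (x ∩ tch E F) = tst E B d F x := by
  unfold tst; rw [wst_inter E x F hx]

lemma sst_inter (E x : Finset (Sym2 V)) (B : Finset V) (d : ℝ) (F : Finset V) (hx : x ⊆ E) :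
    sst E B d F (x ∩ tch E F) = sst E B d F x := by
  unfold sst; rw [tst_inter E x B d F hx, nbr_inter E x F hx]

lemma nbr_subset (x : Finset (Sym2 V)) (F C : Finset V) (hC : IsCoverOf C x)
    (hF : ∀ u ∈ F, u ∉ C) : nbr x F ⊆ C := by
  intro w hw
  simp only [nbr, mem_filter, mem_univ, true_and] at hw
  obtain ⟨u, hu, h⟩ := hw
  obtain ⟨v, hv, hve⟩ := hC _ h
  rcases Sym2.mem_iff.1 hve with e | e
  · exact absurd (e ▸ hv) (hF u hu)
  · exact e ▸ hv

lemma greedy (x : Finset (Sym2 V)) (B C : Finset V) (D : ℝ) (hD : 0 < D) (hC : IsCoverOf C x) :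
    ∃ F ⊆ B, (∀ u ∈ F, u ∉ C) ∧ (F.card : ℝ) * D ≤ C.card ∧
      ∀ v ∈ B, v ∉ C → ((nbr x {v} \ nbr x F).card : ℝ) ≤ D := by
  obtain ⟨F, hF, hmax⟩ := exists_max_image
    ((B \ C).powerset.filter fun F => (F.card : ℝ) * D ≤ (nbr x F).card) card
    ⟨∅, by simp⟩
  simp only [mem_filter, mem_powerset] at hF hmax
  obtain ⟨hFB, hFD⟩ := hF
  have hFC : ∀ u ∈ F, u ∉ C := fun u hu => (mem_sdiff.1 (hFB hu)).2
  refine ⟨F, hFB.trans sdiff_subset, hFC, hFD.trans ?_, ?_⟩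
  · exact_mod_cast card_le_card (nbr_subset x F C hC hFC)
  · intro v hv hvC
    by_contra hcon
    push Not at hcon
    have hvF : v ∉ F := by
      intro hvF
      have : nbr x {v} \ nbr x F = ∅ := by
        rw [sdiff_eq_empty_iff_subset]
        intro w hw
        simp only [nbr, mem_filter, mem_univ, true_and, mem_singleton, exists_eq_left] at hw ⊢
        exact ⟨v, hvF, hw⟩
      rw [this] at hcon
      simp at hcon
      linarith
    have hun : nbr x (insert v F) = nbr x F ∪ (nbr x {v} \ nbr x F) := by
      rw [union_sdiff_self_eq_union]
      ext w
      simp only [nbr, mem_filter, mem_univ, true_and, mem_singleton, exists_eq_left, mem_union,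
        mem_insert, exists_eq_or_imp]
      exact or_comm
    have := hmax (insert v F) ⟨?_, ?_⟩
    · rw [card_insert_of_notMem hvF] at this
      omega
    · exact insert_subset (mem_sdiff.2 ⟨hv, hvC⟩) hFB
    · rw [hun, card_union_of_disjoint disjoint_sdiff, card_insert_of_notMem hvF]
      push_cast
      nlinarith

lemma edges_le (E x : Finset (Sym2 V)) (B : Finset V) (d : ℝ) (F : Finset V) (hd0 : 0 ≤ d) :
    ((rst (sst E B d F x) E).card : ℝ) ≤ B.card * d + (rst B E).card := by
  have hd : ∀ v ∈ (B ∩ wst F x) \ tst E B d F x, ((inc E (wst F x) v).card : ℝ) ≤ d := by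
    intro v hv
    rw [mem_sdiff, tst, mem_filter, not_and] at hv
    exact not_lt.1 (hv.2 hv.1)
  · have sub : rst (sst E B d F x) E ⊆
        ((B ∩ wst F x) \ tst E B d F x).biUnion (fun v => inc E (wst F x) v) ∪ rst B E := by
      intro e he
      rw [rst, mem_filter] at he
      rw [mem_union]
      by_cases hB : ∀ v ∈ e, v ∉ B
      · right
        rw [rst, mem_filter]
        exact ⟨he.1, hB⟩
      · left
        push Not at hB
        obtain ⟨v, hve, hvB⟩ := hB
        have hW : ∀ u ∈ e, u ∈ wst F x := by
          intro u hu
          have := he.2 u hu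
          rw [sst, mem_union, not_or] at this
          rw [wst, mem_sdiff]
          exact ⟨mem_univ _, this.1⟩
        rw [mem_biUnion]
        refine ⟨v, ?_, ?_⟩
        · rw [mem_sdiff, mem_inter]
          refine ⟨⟨hvB, hW v hve⟩, ?_⟩
          have := he.2 v hve
          rw [sst, mem_union, not_or] at this
          exact this.2
        · rw [inc, mem_filter]
          exact ⟨he.1, hve, hW⟩
    have c1 := (card_le_card sub).trans (card_union_le _ _)
    have c2 : ((((B ∩ wst F x) \ tst E B d F x).biUnion
        (fun v => inc E (wst F x) v)).card : ℝ) ≤ B.card * d := by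
      have q1 : (((((B ∩ wst F x) \ tst E B d F x).biUnion
        (fun v => inc E (wst F x) v)).card : ℕ) : ℝ) ≤
          ∑ v ∈ (B ∩ wst F x) \ tst E B d F x, ((inc E (wst F x) v).card : ℝ) := by
        exact_mod_cast card_biUnion_le
      refine q1.trans ((sum_le_card_nsmul _ _ d hd).trans ?_)
      rw [nsmul_eq_mul]
      apply mul_le_mul_of_nonneg_right _ hd0
      exact_mod_cast card_le_card (sdiff_subset.trans inter_subset_left)
    have c3 : ((rst (sst E B d F x) E).card : ℝ) ≤ ((((B ∩ wst F x) \ tst E B d F x).biUnion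
        (fun v => inc E (wst F x) v)).card : ℝ) + (rst B E).card := by exact_mod_cast c1
    linarith

lemma edg_lower (E x : Finset (Sym2 V)) (B : Finset V) (d : ℝ) (F R : Finset V)
    (hR : R ⊆ tst E B d F x) : (R.card : ℝ) * d ≤ 2 * (edg E (wst F x) R).card := by
  set W := wst F x with hW
  have q1 : (R.card : ℝ) * d ≤ ∑ v ∈ R, ((inc E W v).card : ℝ) := by
    rw [← nsmul_eq_mul]
    refine card_nsmul_le_sum _ _ _ fun v hv => ?_
    have := hR hv
    rw [tst, mem_filter] at this
    exact this.2.le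
  refine q1.trans ?_
  have q2 : ∑ v ∈ R, (inc E W v).card = ∑ v ∈ R, ∑ e ∈ edg E W R, if v ∈ e then 1 else 0 := by
    refine sum_congr rfl fun v hv => ?_
    rw [← card_filter]
    congr 1
    ext e
    simp only [inc, edg, mem_filter]
    constructor
    · rintro ⟨a, b, c⟩
      exact ⟨⟨a, ⟨v, hv, b⟩, c⟩, b⟩
    · rintro ⟨⟨a, _, c⟩, b⟩
      exact ⟨a, b, c⟩
  have q3 : ∑ v ∈ R, ∑ e ∈ edg E W R, (if v ∈ e then 1 else 0) ≤ 2 * (edg E W R).card := by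
    rw [sum_comm, mul_comm, ← smul_eq_mul]
    refine sum_le_card_nsmul _ _ _ fun e _ => ?_
    rw [← card_filter]
    have : R.filter (fun v => v ∈ e) ⊆ {(Quot.out e).1, (Quot.out e).2} := by
      intro v hv
      rw [mem_filter] at hv
      have h2 : v ∈ s((Quot.out e).1, (Quot.out e).2) := by
        have : s((Quot.out e).1, (Quot.out e).2) = e := Quot.out_eq e
        rw [this]; exact hv.2
      simpa using Sym2.mem_iff.1 h2
    exact (card_le_card this).trans card_le_two
  have : ∑ v ∈ R, (inc E W v).card ≤ 2 * (edg E W R).card := q2 ▸ q3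
  exact_mod_cast this

lemma edg_upper (E x : Finset (Sym2 V)) (F R : Finset V) (D : ℝ)
    (hRD : ∀ v ∈ R, ((nbr x {v} \ nbr x F).card : ℝ) ≤ D) :
    ((x ∩ edg E (wst F x) R).card : ℝ) ≤ R.card * D := by
  have sub : x ∩ edg E (wst F x) R ⊆
      R.biUnion fun v => (nbr x {v} \ nbr x F).image fun w => s(v, w) := by
    intro e he
    rw [mem_inter, edg, mem_filter] at he
    obtain ⟨hex, _, ⟨v, hvR, hve⟩, hW⟩ := he
    rw [mem_biUnion]
    refine ⟨v, hvR, ?_⟩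
    rw [mem_image]
    obtain ⟨w, rfl⟩ := Sym2.mem_iff_exists.1 hve
    refine ⟨w, ?_, rfl⟩
    have := hW w (Sym2.mem_mk_right _ _)
    rw [wst, mem_sdiff, mem_union, not_or] at this
    rw [mem_sdiff]
    refine ⟨?_, this.2.2⟩
    simp only [nbr, mem_filter, mem_univ, true_and, mem_singleton, exists_eq_left]
    exact hex
  have c1 : ((x ∩ edg E (wst F x) R).card : ℝ) ≤
      ∑ v ∈ R, (((nbr x {v} \ nbr x F).image fun w => s(v, w)).card : ℝ) := by
    exact_mod_cast (card_le_card sub).trans card_biUnion_le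
  refine c1.trans ?_
  rw [← nsmul_eq_mul]
  refine sum_le_card_nsmul _ _ _ fun v hv => le_trans ?_ (hRD v hv)
  exact_mod_cast card_image_le

lemma cost_le (E x : Finset (Sym2 V)) (B C : Finset V) (d : ℝ) (F : Finset V)
    (hC : IsCoverOf C x) (hF : ∀ u ∈ F, u ∉ C) :
    (sst E B d F x).card + tau (rst (sst E B d F x) x) ≤
      C.card + F.card + (tst E B d F x \ C).card := by
  set S := sst E B d F x with hS
  have h1 : tau (rst S x) ≤ (C \ S).card := by
    apply tau_le
    intro e he
    rw [rst, mem_filter] at he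
    obtain ⟨v, hv, hve⟩ := hC e he.1
    exact ⟨v, mem_sdiff.2 ⟨hv, he.2 v hve⟩, hve⟩
  have h2 : S ⊆ (C ∩ S) ∪ (F ∪ (tst E B d F x \ C)) := by
    intro v hv
    have hn := @nbr_subset _ _ _ x F C hC hF v
    have hv' := hv
    rw [hS, sst] at hv'
    simp only [mem_union, mem_inter, mem_sdiff] at hv' ⊢
    tauto
  have h3 := card_le_card h2
  have h4 := card_union_le (C ∩ S) (F ∪ (tst E B d F x \ C))
  have h5 := card_union_le F (tst E B d F x \ C)
  have h6 := card_sdiff_add_card_inter C S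
  omega

lemma prE_true (p : ℝ) (h0 : 0 ≤ p) (h1 : p ≤ 1) (E : Finset (Sym2 V))
    (A : Finset (Sym2 V) → Prop) (h : ∀ x ⊆ E, A x) : 1 ≤ prE p E A := by
  unfold prE
  refine le_trans (le_of_eq (expVal_const p 1 E).symm) ?_
  refine expVal_mono p h0 h1 E _ _ fun x hx => ?_
  simp [h x hx]

lemma base_set (p : ℝ) (h0 : 0 < p) (h1 : p ≤ 1) (E : Finset (Sym2 V)) (opt : ℝ)
    (hopt : opt = expVal p E (fun x => (tau x : ℝ))) (hpos : 0 < opt) :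
    ∃ B : Finset V, (B.card : ℝ) ≤ 2 * opt ∧
      ((rst B E).card : ℝ) ≤ 4 * Fintype.card V / p := by
  by_contra hcon
  push Not at hcon
  have hn : 1 ≤ Fintype.card V := by
    by_contra hn
    have hn : Fintype.card V = 0 := by omega
    have : opt ≤ expVal p E (fun _ => 0) := by
      rw [hopt]
      refine expVal_mono p h0.le h1 E _ _ fun x _ => ?_
      have := tau_le x univ (cover_univ x)
      rw [card_univ, hn] at this
      have : tau x = 0 := by omega
      simp [this]
    rw [expVal_const] at this
    linarith
  set Q := (univ : Finset (Finset V)).filter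
    (fun C => 4 * (Fintype.card V : ℝ) / p < ((rst C E).card : ℝ)) with hQ
  have all : ∀ x ⊆ E, (2 * opt ≤ (tau x : ℝ)) ∨
      ∃ C ∈ Q, ((x ∩ rst C E).card : ℝ) ≤ 0 := by
    intro x hx
    by_cases h : 2 * opt ≤ (tau x : ℝ)
    · exact Or.inl h
    · right
      obtain ⟨C, hC, hc⟩ := tau_spec x
      refine ⟨C, mem_filter.2 ⟨mem_univ _, hcon C ?_⟩, ?_⟩
      · rw [hc]; linarith
      · have : x ∩ rst C E = ∅ := by
          rw [eq_empty_iff_forall_notMem]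
          intro e he
          rw [mem_inter, rst, mem_filter] at he
          obtain ⟨v, hv, hve⟩ := hC e he.1
          exact he.2.2 v hve hv
        simp [this]
  have t0 := prE_true p h0.le h1 E _ all
  have t1 := prE_or p h0.le h1 E (fun x => 2 * opt ≤ (tau x : ℝ))
    (fun x => ∃ C ∈ Q, ((x ∩ rst C E).card : ℝ) ≤ 0)
  have t2 := prE_markov p h0.le h1 E (fun x => (tau x : ℝ)) (fun _ _ => Nat.cast_nonneg _)
    (2 * opt)
  rw [← hopt] at t2
  have t3 : prE p E (fun x => 2 * opt ≤ (tau x : ℝ)) ≤ 1 / 2 := by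
    by_contra h
    push Not at h
    nlinarith
  have t4 := prE_exists p h0.le h1 E Q (fun C x => ((x ∩ rst C E).card : ℝ) ≤ 0)
  have t5 : ∑ C ∈ Q, prE p E (fun x => ((x ∩ rst C E).card : ℝ) ≤ 0) ≤
      Q.card * (1/5 : ℝ) ^ (Fintype.card V) := by
    rw [← nsmul_eq_mul]
    refine sum_le_card_nsmul _ _ _ fun C hC => ?_
    rw [hQ, mem_filter] at hC
    refine (prE_chernoff p h0.le h1 (rst C E) E (filter_subset _ _) 0).trans ?_
    have a1 : 4 * (Fintype.card V : ℝ) < p * (rst C E).card := by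
      have := hC.2
      rw [div_lt_iff₀ h0] at this
      linarith
    have a2 : Real.exp (-2) ≤ 1/5 := by
      rw [Real.exp_neg, one_div]
      apply inv_anti₀ (by norm_num)
      have := Real.quadratic_le_exp_of_nonneg (x := 2) (by norm_num)
      linarith
    calc Real.exp (0 - p * (rst C E).card / 2) ≤ Real.exp ((Fintype.card V : ℝ) * (-2)) := by
          apply Real.exp_le_exp.2; linarith
      _ = Real.exp (-2) ^ (Fintype.card V) := by rw [Real.exp_nat_mul]
      _ ≤ _ := pow_le_pow_left₀ (Real.exp_pos _).le a2 _
  have t6 : (Q.card : ℝ) ≤ 2 ^ (Fintype.card V) := by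
    have : Q.card ≤ 2 ^ (Fintype.card V) := by
      refine (card_le_univ Q).trans ?_
      rw [Fintype.card_finset]
    exact_mod_cast this
  have t7 : (Q.card : ℝ) * (1/5 : ℝ) ^ (Fintype.card V) ≤ 2/5 := by
    calc (Q.card : ℝ) * (1/5 : ℝ) ^ (Fintype.card V) ≤
          2 ^ (Fintype.card V) * (1/5 : ℝ) ^ (Fintype.card V) :=
          mul_le_mul_of_nonneg_right t6 (by positivity)
      _ = (2/5 : ℝ) ^ (Fintype.card V) := by rw [← mul_pow]; norm_num
      _ ≤ 2/5 := pow_le_of_le_one (by norm_num) (by norm_num) (by omega)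
  linarith

lemma count_small (B : Finset V) (ε opt : ℝ) (he : 0 < ε) (he4 : ε < 1/4) (hpos : 0 < opt)
    (hB : (B.card : ℝ) ≤ 2 * opt) :
    (((B.powerset.filter fun F => (F.card : ℝ) ≤ 2 * ε ^ 4 * opt).card : ℕ) : ℝ) ≤
      Real.exp (3 * ε ^ 2 * opt) := by
  set L := Real.log (1 / ε) with hL
  have hL1 : L ≤ 1 / ε := (Real.log_le_self (by positivity))
  have hL0 : 0 ≤ L := Real.log_nonneg (by rw [le_div_iff₀ he]; linarith)
  have hexp : Real.exp (-L) = ε := by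
    rw [hL, one_div, Real.log_inv, neg_neg, Real.exp_log he]
  set q := 2 * ε ^ 4 * opt with hq
  have hq0 : 0 ≤ q := by positivity
  have s1 : (((B.powerset.filter fun F => (F.card : ℝ) ≤ q).card : ℕ) : ℝ) ≤
      ∑ F ∈ B.powerset, Real.exp (2 * L * q) * (ε ^ 2) ^ F.card := by
    rw [card_eq_sum_ones, Nat.cast_sum]
    refine le_trans ?_ (sum_le_sum_of_subset_of_nonneg
      (filter_subset (fun F : Finset V => (F.card : ℝ) ≤ q) B.powerset)
      (fun F _ _ => by positivity))
    refine sum_le_sum fun F hF => ?_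
    rw [mem_filter] at hF
    have : (ε ^ 2) ^ F.card = Real.exp (F.card * (-(2 * L))) := by
      rw [Real.exp_nat_mul]
      congr 1
      rw [← hexp, ← Real.exp_nat_mul]
      congr 1
      push_cast; ring
    rw [this, ← Real.exp_add, Nat.cast_one]
    apply Real.one_le_exp
    have := mul_nonneg hL0 (sub_nonneg.2 hF.2)
    nlinarith
  refine s1.trans ?_
  rw [← mul_sum]
  have s2 : ∑ F ∈ B.powerset, (ε ^ 2) ^ F.card = (ε ^ 2 + 1) ^ B.card := by
    rw [← Finset.sum_pow_mul_eq_add_pow]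
    simp
  have s3 : (ε ^ 2 + 1) ^ B.card ≤ Real.exp (B.card * ε ^ 2) := by
    rw [Real.exp_nat_mul]
    exact pow_le_pow_left₀ (by positivity) (Real.add_one_le_exp _) _
  rw [s2]
  refine (mul_le_mul_of_nonneg_left s3 (Real.exp_pos _).le).trans ?_
  rw [← Real.exp_add]
  apply Real.exp_le_exp.2
  have b1 : (B.card : ℝ) * ε ^ 2 ≤ 2 * opt * ε ^ 2 :=
    mul_le_mul_of_nonneg_right hB (by positivity)
  have b2 : 2 * L * q ≤ 2 * (1 / ε) * q :=
    mul_le_mul_of_nonneg_right (by linarith) hq0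
  have b3 : 2 * (1 / ε) * q = 4 * ε * (ε ^ 2 * opt) := by
    rw [hq]; field_simp; ring
  have b4 : 4 * ε * (ε ^ 2 * opt) ≤ 1 * (ε ^ 2 * opt) :=
    mul_le_mul_of_nonneg_right (by linarith) (by positivity)
  linarith

lemma core (p ε : ℝ) (h0 : 0 < p) (h1 : p ≤ 1) (he : 0 < ε) (he4 : ε < 1/4)
    (E : Finset (Sym2 V)) (opt : ℝ)
    (hopt : opt = expVal p E (fun x => (tau x : ℝ)))
    (hlow : 23 * Real.log (1 / ε) / ε ^ 2 ≤ opt) :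
    ∃ S : Finset V, ((rst S E).card : ℝ) ≤ 2 * 10 ^ 3 * Fintype.card V / (ε ^ 5 * p) ∧
      (S.card : ℝ) + expVal p E (fun x => (tau (rst S x) : ℝ)) ≤ (1 + 23 * ε) * opt := by
  have hL0 : 0 < Real.log (1 / ε) := Real.log_pos (by rw [lt_div_iff₀ he]; linarith)
  have hpos : 0 < opt := lt_of_lt_of_le (by positivity) hlow
  obtain ⟨B, hB1, hB2⟩ := base_set p h0 h1 E opt hopt hpos
  by_contra hcon
  push Not at hcon
  set D : ℝ := 1 / ε ^ 4 with hD
  have hD0 : 0 < D := by positivity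
  set d : ℝ := 8 * D / p with hd
  have hd0 : 0 ≤ d := by positivity
  have hBn : (B.card : ℝ) ≤ Fintype.card V := by exact_mod_cast card_le_univ B
  have few : ∀ F x, ((rst (sst E B d F x) E).card : ℝ) ≤
      2 * 10 ^ 3 * Fintype.card V / (ε ^ 5 * p) := by
    intro F x
    refine (edges_le E x B d F hd0).trans ?_
    have a1 : (B.card : ℝ) * d ≤ Fintype.card V * d := mul_le_mul_of_nonneg_right hBn hd0
    have a2 : (Fintype.card V : ℝ) * d + 4 * Fintype.card V / p =
        (Fintype.card V / (ε ^ 5 * p)) * (8 * ε + 4 * ε ^ 5) := by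
      rw [hd, hD]; field_simp
    have a3 : 8 * ε + 4 * ε ^ 5 ≤ 2 * 10 ^ 3 := by
      have : ε ^ 5 ≤ 1 := pow_le_one₀ he.le (by linarith)
      linarith
    have a4 : (Fintype.card V / (ε ^ 5 * p)) * (8 * ε + 4 * ε ^ 5) ≤
        (Fintype.card V / (ε ^ 5 * p)) * (2 * 10 ^ 3) :=
      mul_le_mul_of_nonneg_left a3 (by positivity)
    have a5 : ((Fintype.card V : ℝ) / (ε ^ 5 * p)) * (2 * 10 ^ 3) =
      2 * 10 ^ 3 * Fintype.card V / (ε ^ 5 * p) := by ring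
    linarith
  set Ev1 : Finset V → Finset (Sym2 V) → Finset (Sym2 V) → Prop := fun F x1 x =>
    ∃ R ∈ (tst E B d F x1).powerset.filter (fun R => ε * opt ≤ (R.card : ℝ)),
      ((x ∩ edg E (wst F x1) R).card : ℝ) ≤ R.card * D with hEv1
  set Ev2 : Finset V → Finset (Sym2 V) → Finset (Sym2 V) → Prop := fun F x1 x =>
    (tau (rst (sst E B d F x1) x) : ℝ) ≤ (1 + 3 * ε) * opt - (sst E B d F x1).card with hEv2
  have pr1 : ∀ F x1, prE p E (Ev1 F x1) ≤ Real.exp (-(100 * ε ^ 2 * opt)) := by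
    intro F x1
    rw [hEv1]
    refine (prE_exists p h0.le h1 E _ _).trans ?_
    have each : ∀ R ∈ (tst E B d F x1).powerset.filter (fun R => ε * opt ≤ (R.card : ℝ)),
        prE p E (fun x => ((x ∩ edg E (wst F x1) R).card : ℝ) ≤ R.card * D) ≤
          Real.exp (-(opt / ε ^ 3)) := by
      intro R hR
      rw [mem_filter, mem_powerset] at hR
      refine (prE_chernoff p h0.le h1 (edg E (wst F x1) R) E (filter_subset _ _) _).trans ?_
      apply Real.exp_le_exp.2
      have a1 := edg_lower E x1 B d F R hR.1
      have a2 : p * ((R.card : ℝ) * d) = 8 * (R.card * D) := by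
        rw [hd]; field_simp
      have a3 := mul_le_mul_of_nonneg_left a1 h0.le
      have a4 : ε * opt * D ≤ R.card * D := mul_le_mul_of_nonneg_right hR.2 hD0.le
      have a5 : ε * opt * D = opt / ε ^ 3 := by rw [hD]; field_simp
      linarith
    refine (sum_le_card_nsmul _ _ _ each).trans ?_
    rw [nsmul_eq_mul]
    have c1 : (((tst E B d F x1).powerset.filter
        (fun R => ε * opt ≤ (R.card : ℝ))).card : ℝ) ≤ Real.exp (2 * opt) := by
      have q1 : ((tst E B d F x1).powerset.filter
          (fun R => ε * opt ≤ (R.card : ℝ))).card ≤ 2 ^ B.card := by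
        rw [← card_powerset]
        apply card_le_card
        refine (filter_subset _ _).trans (powerset_mono.2 ?_)
        exact (filter_subset _ _).trans inter_subset_left
      have q2 : (2:ℝ) ^ B.card ≤ Real.exp (B.card * 1) := by
        rw [Real.exp_nat_mul]
        apply pow_le_pow_left₀ (by norm_num)
        have := Real.add_one_le_exp (1:ℝ)
        linarith
      calc _ ≤ (2:ℝ) ^ B.card := by exact_mod_cast q1
        _ ≤ _ := q2
        _ ≤ _ := Real.exp_le_exp.2 (by linarith)
    refine (mul_le_mul_of_nonneg_right c1 (Real.exp_pos _).le).trans ?_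
    rw [← Real.exp_add]
    apply Real.exp_le_exp.2
    have e1 : 64 ≤ 1 / ε ^ 3 := by
      rw [le_div_iff₀ (by positivity)]
      have : ε ^ 3 ≤ (1/4) ^ 3 := pow_le_pow_left₀ he.le he4.le 3
      linarith
    have e2 : ε ^ 2 ≤ (1/4) ^ 2 := pow_le_pow_left₀ he.le he4.le 2
    have e3 : 64 * opt ≤ opt / ε ^ 3 := by
      have := mul_le_mul_of_nonneg_right e1 hpos.le
      calc _ ≤ _ := this
        _ = _ := by ring
    nlinarith
  have pr2 : ∀ F x1, prE p E (Ev2 F x1) ≤ Real.exp (-(100 * ε ^ 2 * opt)) := by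
    intro F x1
    have hc := hcon _ (few F x1)
    have lt := lower_tail p h0.le h1 E (sst E B d F x1) opt (20 * ε * opt)
      ((1 + 3 * ε) * opt - (sst E B d F x1).card) hpos (by positivity) ?_ (by linarith)
    · refine lt.trans (le_of_eq ?_)
      congr 1
      field_simp
      ring
    · rw [hopt]
      refine expVal_mono p h0.le h1 E _ _ fun x _ => ?_
      exact_mod_cast tau_mono _ _ (filter_subset _ _)
  have prF : ∀ F, prE p E (fun x => Ev1 F (x ∩ tch E F) x ∨ Ev2 F (x ∩ tch E F) x) ≤
      2 * Real.exp (-(100 * ε ^ 2 * opt)) := by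
    intro F
    refine prE_decouple p h0.le h1 (tch E F) E (filter_subset _ _)
      (fun x1 x => Ev1 F x1 x ∨ Ev2 F x1 x) _ ?_ ?_
    · intro x1 _ x hx
      have i1 : ∀ R, (x \ tch E F) ∩ edg E (wst F x1) R = x ∩ edg E (wst F x1) R := by
        intro R
        ext e
        simp only [mem_inter, mem_sdiff, tch, edg, mem_filter]
        constructor
        · rintro ⟨⟨a, _⟩, b⟩
          exact ⟨a, b⟩
        · rintro ⟨a, b⟩
          refine ⟨⟨a, ?_⟩, b⟩
          rintro ⟨_, u, hu, hue⟩
          have := b.2.2 u hue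
          rw [wst, mem_sdiff, mem_union] at this
          tauto
      have i2 : rst (sst E B d F x1) (x \ tch E F) = rst (sst E B d F x1) x := by
        ext e
        simp only [rst, mem_sdiff, tch, mem_filter]
        constructor
        · rintro ⟨⟨a, _⟩, b⟩
          exact ⟨a, b⟩
        · rintro ⟨a, b⟩
          refine ⟨⟨a, ?_⟩, b⟩
          rintro ⟨_, u, hu, hue⟩
          apply b u hue
          rw [sst, mem_union, mem_union]
          tauto
      simp only [hEv1, hEv2, i1, i2]
    · intro x1 _
      refine (prE_or p h0.le h1 E _ _).trans ?_
      have := pr1 F x1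
      have := pr2 F x1
      linarith
  set Fs := B.powerset.filter fun F => (F.card : ℝ) ≤ 2 * ε ^ 4 * opt with hFs
  have good : ∀ x ⊆ E, ¬ ((1 + ε) * opt ≤ (tau x : ℝ)) →
      ∃ F ∈ Fs, (Ev1 F (x ∩ tch E F) x ∨ Ev2 F (x ∩ tch E F) x) := by
    intro x hx hsmall
    push Not at hsmall
    obtain ⟨C, hC, hCc⟩ := tau_spec x
    rw [← hCc] at hsmall
    obtain ⟨F, hFB, hFC, hFD, hdeg⟩ := greedy x B C D hD0 hC
    have hFq : (F.card : ℝ) ≤ 2 * ε ^ 4 * opt := by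
      rw [hD, mul_one_div, div_le_iff₀ (by positivity)] at hFD
      have : (C.card : ℝ) * ε ^ 4 ≤ 2 * opt * ε ^ 4 :=
        mul_le_mul_of_nonneg_right (by nlinarith) (by positivity)
      linarith
    refine ⟨F, mem_filter.2 ⟨mem_powerset.2 hFB, hFq⟩, ?_⟩
    simp only [hEv1, hEv2, wst_inter E x F hx, tst_inter E x B d F hx, sst_inter E x B d F hx]
    by_cases hR : ε * opt ≤ ((tst E B d F x \ C).card : ℝ)
    · left
      refine ⟨tst E B d F x \ C, mem_filter.2 ⟨mem_powerset.2 sdiff_subset, hR⟩, ?_⟩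
      apply edg_upper
      intro v hv
      rw [mem_sdiff, tst, mem_filter, mem_inter] at hv
      exact hdeg v hv.1.1.1 hv.2
    · right
      push Not at hR
      have c := cost_le E x B C d F hC hFC
      have c' : ((sst E B d F x).card : ℝ) + tau (rst (sst E B d F x) x) ≤
        C.card + F.card + (tst E B d F x \ C).card := by exact_mod_cast c
      have : 2 * ε ^ 4 * opt ≤ ε * opt := by
        apply mul_le_mul_of_nonneg_right _ hpos.le
        have : ε ^ 3 ≤ (1/4) ^ 3 := pow_le_pow_left₀ he.le he4.le 3
        nlinarith
      linarith
  have g1 := prE_not p E (fun x => (1 + ε) * opt ≤ (tau x : ℝ))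
  have g2 := prE_markov p h0.le h1 E (fun x => (tau x : ℝ)) (fun _ _ => Nat.cast_nonneg _)
    ((1 + ε) * opt)
  rw [← hopt] at g2
  have g3 : (1 + ε) * prE p E (fun x => (1 + ε) * opt ≤ (tau x : ℝ)) ≤ 1 := by
    by_contra h
    push Not at h
    nlinarith
  have g4 := prE_mono p h0.le h1 E _ _ good
  have g5 := prE_exists p h0.le h1 E Fs
    (fun F x => Ev1 F (x ∩ tch E F) x ∨ Ev2 F (x ∩ tch E F) x)
  have g6 := sum_le_card_nsmul Fs _ _ (fun F _ => prF F)
  rw [nsmul_eq_mul] at g6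
  have g7 := mul_le_mul_of_nonneg_right (count_small B ε opt he he4 hpos hB1)
    (by positivity : 0 ≤ 2 * Real.exp (-(100 * ε ^ 2 * opt)))
  have g8 : Real.exp (3 * ε ^ 2 * opt) * (2 * Real.exp (-(100 * ε ^ 2 * opt))) ≤ 2 * ε ^ 2 := by
    have : Real.exp (3 * ε ^ 2 * opt) * (2 * Real.exp (-(100 * ε ^ 2 * opt))) =
        2 * Real.exp (-(97 * (ε ^ 2 * opt))) := by
      rw [mul_left_comm, ← Real.exp_add]
      congr 2
      ring
    rw [this]
    apply mul_le_mul_of_nonneg_left _ (by norm_num)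
    have e2 : ε ^ 2 = Real.exp (-(2 * Real.log (1 / ε))) := by
      rw [one_div, Real.log_inv, mul_neg, neg_neg]
      have : (2:ℝ) * Real.log ε = (2:ℕ) * Real.log ε := by norm_num
      rw [this, Real.exp_nat_mul, Real.exp_log he]
    conv_rhs => rw [e2]
    apply Real.exp_le_exp.2
    rw [div_le_iff₀ (by positivity)] at hlow
    nlinarith
  set P := prE p E (fun x => (1 + ε) * opt ≤ (tau x : ℝ)) with hP
  have g9 : 1 - P ≤ 2 * ε ^ 2 := by linarith
  nlinarith

/-- Theorem 4.9, performance of the Vertex-Cover algorithm. There is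
an absolute constant `K > 0` such that for every finite simple graph `G`, every
`p ∈ (0,1]`, every `ε ∈ (0, 1/4)`, and every minimum-vertex-cover function `MVC`, if
`opt ≥ K·log(1/ε)/ε²`, then the minimum over all sets `S ⊆ V` whose complement induces
at most `2·10³·n/(ε⁵·p)` edges of `|S| + E[|MVC(G*[V \ S])|]` is at most
`(1 + K·ε)·opt`. -/
theorem vertex_cover_algorithm_guarantee :
    ∃ K : ℝ, 0 < K ∧
      ∀ (V : Type) [Fintype V] [DecidableEq V]
        (G : SimpleGraph V) [DecidableRel G.Adj]
        (p ε : ℝ) (MVC : Finset (Sym2 V) → Finset V),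
        0 < p → p ≤ 1 → 0 < ε → ε < 1 / 4 →
        IsMinCoverFn G.edgeFinset MVC →
        K * Real.log (1 / ε) / ε ^ 2 ≤ optVal p G.edgeFinset MVC →
        ∃ S : Finset V,
          (inducedEdgeCount G S : ℝ) ≤ 2 * 10 ^ 3 * Fintype.card V / (ε ^ 5 * p) ∧
          (S.card : ℝ) +
              expVal p G.edgeFinset
                (fun F => ((MVC (F.filter fun e => ∀ v ∈ e, v ∉ S)).card : ℝ)) ≤
            (1 + K * ε) * optVal p G.edgeFinset MVC := by
  refine ⟨23, by norm_num, ?_⟩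
  intro V _ _ G _ p ε MVC hp hp1 he he4 hM hlow
  have hopt : optVal p G.edgeFinset MVC = expVal p G.edgeFinset (fun x => (tau x : ℝ)) := by
    unfold optVal
    refine expVal_congr p _ _ _ fun F hF => ?_
    rw [mvc_card _ MVC hM F hF]
  obtain ⟨S, hS1, hS2⟩ := core p ε hp hp1 he he4 G.edgeFinset _ hopt hlow
  refine ⟨S, hS1, ?_⟩
  refine le_trans (le_of_eq ?_) hS2
  congr 1
  refine expVal_congr p _ _ _ fun F hF => ?_
  rw [mvc_card _ MVC hM _ ((filter_subset _ _).trans hF)]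
  rfl
end
end
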